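/- The reduction from set cover to multi-interval set cover is approximation-preserving: Let n, m be natural numbers with 0 < n and S : Fin m → Set (Fin n). For every natural number κ, there exists a finite index set I ⊆ Fin m with |I| ≤ κ such that Set.Icc (0 : ℝ) n ⊆ ⋃_{i ∈ I} ⋃_{j ∈ S i} Set.Icc (j : ℝ) ((j : ℝ) + 1) if and only if there exists a finite I ⊆ Fin m with |I| ≤ κ and ⋃_{i ∈ I} S i = Set.univ. In particular, the minimum sizes of feasible solutions of the two instances are equal. -/

import Mathlib

/-- Among the unit intervals with integer left endpoint, only `[j, j + 1]` contains `j + 1 / 2`. -/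
theorem natCast_add_half_mem_Icc_iff {j k : ℕ} :
    (j : ℝ) + 1 / 2 ∈ Set.Icc (k : ℝ) ((k : ℝ) + 1) ↔ k = j := by
  refine ⟨fun ⟨h₁, h₂⟩ => ?_, ?_⟩
  · have hkj : (k : ℝ) < (j : ℝ) + 1 := by linarith
    have hjk : (j : ℝ) < (k : ℝ) + 1 := by linarith
    norm_cast at hkj hjk
    omega
  · rintro rfl
    constructor <;> linarith

/-- The unit intervals with left endpoints `0, …, n - 1` cover `[0, n]`. -/
theorem exists_fin_mem_Icc_natCast {n : ℕ} (hn : 0 < n) {x : ℝ} (hx : x ∈ Set.Icc (0 : ℝ) n) :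
    ∃ j : Fin n, x ∈ Set.Icc ((j : ℕ) : ℝ) (((j : ℕ) : ℝ) + 1) := by
  obtain hxn | rfl := hx.2.lt_or_eq
  · exact ⟨⟨⌊x⌋₊, (Nat.floor_lt hx.1).2 hxn⟩, Nat.floor_le hx.1, (Nat.lt_floor_add_one x).le⟩
  · refine ⟨⟨n - 1, by omega⟩, ?_⟩
    simp [Nat.cast_pred hn]

/-- A set of elements of `Fin n` is everything iff the corresponding unit intervals cover
`[0, n]`. -/
theorem Icc_subset_iUnion_Icc_natCast_iff {n : ℕ} (hn : 0 < n) {T : Set (Fin n)} :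
    Set.Icc (0 : ℝ) n ⊆ ⋃ j ∈ T, Set.Icc ((j : ℕ) : ℝ) (((j : ℕ) : ℝ) + 1) ↔ T = Set.univ := by
  refine ⟨fun h => Set.eq_univ_of_forall fun j => ?_, ?_⟩
  · have hj : ((j : ℕ) : ℝ) + 1 ≤ n := by exact_mod_cast j.isLt
    have hmem : ((j : ℕ) : ℝ) + 1 / 2 ∈ Set.Icc (0 : ℝ) n :=
      ⟨by positivity, by linarith⟩
    obtain ⟨k, hkT, hk⟩ := Set.mem_iUnion₂.1 (h hmem)
    rwa [← Fin.ext (natCast_add_half_mem_Icc_iff.1 hk)]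
  · rintro rfl x hx
    obtain ⟨j, hj⟩ := exists_fin_mem_Icc_natCast hn hx
    exact Set.mem_iUnion₂.2 ⟨j, Set.mem_univ j, hj⟩

theorem setCover_to_multiIntervalSetCover_approx_preserving
    (n m : ℕ) (hn : 0 < n) (S : Fin m → Set (Fin n)) (κ : ℕ) :
    (∃ I : Finset (Fin m), I.card ≤ κ ∧
        Set.Icc (0 : ℝ) n ⊆
          ⋃ i ∈ I, ⋃ j ∈ S i, Set.Icc ((j : ℕ) : ℝ) (((j : ℕ) : ℝ) + 1)) ↔
      (∃ I : Finset (Fin m), I.card ≤ κ ∧ ⋃ i ∈ I, S i = Set.univ) := by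
  refine exists_congr fun I => and_congr_right fun _ => ?_
  rw [← Icc_subset_iUnion_Icc_natCast_iff hn]
  simp only [Set.biUnion_iUnion]
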